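/- Let d be a positive integer, let Σ ∈ ℝ^{d×d} be a symmetric positive definite matrix, let β ≥ 0, let θ̂, θ* ∈ ℝ^d satisfy ‖θ̂ − θ*‖_Σ ≤ β, let D ⊆ ℝ^d be nonempty, and let x̂ ∈ D satisfy θ̂ᵀx̂ + β·‖x̂‖_{Σ^{−1}} ≥ θ̂ᵀx + β·‖x‖_{Σ^{−1}} for all x ∈ D. Then for every x* ∈ D one has (θ*)ᵀx* − (θ*)ᵀx̂ ≤ 2β·‖x̂‖_{Σ^{−1}}. -/

import Mathlib

open Matrix Finset

/-- Mahalanobis norm `‖x‖_Σ = √(xᵀ Σ x)`. -/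
noncomputable def mnorm {d : ℕ} (M : Matrix (Fin d) (Fin d) ℝ) (x : Fin d → ℝ) : ℝ :=
  Real.sqrt (x ⬝ᵥ (M *ᵥ x))

/-- Cauchy–Schwarz for the dual pair of Mahalanobis norms. -/
theorem abs_dotProduct_le_mnorm_mul_mnorm_inv {d : ℕ} {M : Matrix (Fin d) (Fin d) ℝ}
    (hM : M.PosDef) (u x : Fin d → ℝ) :
    |u ⬝ᵥ x| ≤ mnorm M u * mnorm M⁻¹ x := by
  have hMinv : M *ᵥ (M⁻¹ *ᵥ x) = x := by
    rw [mulVec_mulVec, mul_nonsing_inv _ ((isUnit_iff_isUnit_det _).mp hM.isUnit), one_mulVec]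
  have hsymm : (M⁻¹ *ᵥ x) ⬝ᵥ (M *ᵥ u) = u ⬝ᵥ x := by
    have hT : Mᵀ = M := by simpa using hM.isHermitian.eq
    rw [dotProduct_mulVec, ← mulVec_transpose, hT, hMinv, dotProduct_comm]
  have hu : 0 ≤ u ⬝ᵥ (M *ᵥ u) := by simpa using hM.posSemidef.dotProduct_mulVec_nonneg u
  have hdiscrim : discrim (u ⬝ᵥ (M *ᵥ u)) (2 * (u ⬝ᵥ x)) (x ⬝ᵥ (M⁻¹ *ᵥ x)) ≤ 0 := by
    refine discrim_le_zero fun t ↦ ?_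
    have h := hM.posSemidef.dotProduct_mulVec_nonneg (t • u + M⁻¹ *ᵥ x)
    simp only [star_trivial, mulVec_add, mulVec_smul, hMinv, add_dotProduct, dotProduct_add,
      smul_dotProduct, dotProduct_smul, smul_eq_mul, hsymm, dotProduct_comm (M⁻¹ *ᵥ x) x] at h
    linarith
  rw [mnorm, mnorm, ← Real.sqrt_mul hu]
  apply Real.abs_le_sqrt
  rw [discrim] at hdiscrim
  linarith

/-- one-step regret bound for the optimistic (UCB-maximizing) action. -/
theorem stmt_1 {d : ℕ} (hd : 0 < d)
    (M : Matrix (Fin d) (Fin d) ℝ) (hM : M.PosDef)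
    (β : ℝ) (hβ : 0 ≤ β)
    (θhat θstar : Fin d → ℝ)
    (hconf : mnorm M (θhat - θstar) ≤ β)
    (D : Set (Fin d → ℝ)) (hD : D.Nonempty)
    (xhat : Fin d → ℝ) (hxhat : xhat ∈ D)
    (hopt : ∀ x ∈ D, θhat ⬝ᵥ xhat + β * mnorm M⁻¹ xhat ≥ θhat ⬝ᵥ x + β * mnorm M⁻¹ x) :
    ∀ xstar ∈ D, θstar ⬝ᵥ xstar - θstar ⬝ᵥ xhat ≤ 2 * β * mnorm M⁻¹ xhat := by
  intro xstar hxstar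
  have hdual (x : Fin d → ℝ) :
      |θhat ⬝ᵥ x - θstar ⬝ᵥ x| ≤ β * mnorm M⁻¹ x := by
    rw [← sub_dotProduct]
    exact (abs_dotProduct_le_mnorm_mul_mnorm_inv hM _ x).trans
      (mul_le_mul_of_nonneg_right hconf (Real.sqrt_nonneg _))
  linarith [hopt xstar hxstar, (abs_le.mp (hdual xstar)).1, (abs_le.mp (hdual xhat)).2]
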